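/- arXiv:1612.05683 — 2 statements merged into one kernel-verified Lean document; each statement's English description precedes it below -/
import Mathlib

section
/- Let H be a complex Hilbert space, T a bounded linear operator on H, K ⊆ ℂ a compact set, and C ≥ 1. If w(F(T)) ≤ (1/2)(C + C⁻¹) · ‖F‖_K for every n ≥ 1 and every n×n matrix polynomial F, then ‖F(T)‖ ≤ C · ‖F‖_K for every n ≥ 1 and every n×n matrix polynomial F. -/
open scoped InnerProductSpace
open ContinuousLinearMap Polynomial

noncomputable section

/-- The numerical radius `w(X) = sup { |⟨X x, x⟩| : ‖x‖ = 1 }` of a bounded operator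
on a complex inner product space. (Here `⟪x, X x⟫_ℂ` is the mathematicians'
`⟨X x, x⟩`, since Mathlib's inner product is conjugate-linear in the first slot.) -/
def numRadius {E : Type*} [NormedAddCommGroup E] [InnerProductSpace ℂ E]
    (X : E →L[ℂ] E) : ℝ :=
  sSup {r : ℝ | ∃ x : E, ‖x‖ = 1 ∧ r = ‖(⟪x, X x⟫_ℂ : ℂ)‖}

/-- The numerical range `W(X) = { ⟨X x, x⟩ : ‖x‖ = 1 }` of a bounded operator
on a complex inner product space. (Here `⟪x, X x⟫_ℂ` is the mathematicians'
`⟨X x, x⟩`, since Mathlib's inner product is conjugate-linear in the first slot.) -/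
def numRange {E : Type*} [NormedAddCommGroup E] [InnerProductSpace ℂ E]
    (X : E →L[ℂ] E) : Set ℂ :=
  {z : ℂ | ∃ x : E, ‖x‖ = 1 ∧ z = ⟪x, X x⟫_ℂ}

/-- The 2×2 block operator `[[A, B], [C, D]]` acting on the Hilbert space
direct sum `H ⊕₂ H`. -/
def blockOp {H : Type*} [NormedAddCommGroup H] [InnerProductSpace ℂ H]
    (A B C D : H →L[ℂ] H) : WithLp 2 (H × H) →L[ℂ] WithLp 2 (H × H) :=
  ((WithLp.prodContinuousLinearEquiv 2 ℂ H H).symm :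
      (H × H) →L[ℂ] WithLp 2 (H × H)) ∘L
    ((A ∘L fst ℂ H H + B ∘L snd ℂ H H).prod (C ∘L fst ℂ H H + D ∘L snd ℂ H H)) ∘L
    ((WithLp.prodContinuousLinearEquiv 2 ℂ H H) : WithLp 2 (H × H) →L[ℂ] (H × H))

/-- Evaluation of an `n × n` matrix polynomial `F = (p_{ij})` at an operator `T`:
the block operator `(p_{ij}(T))` acting on the `n`-fold Hilbert direct sum `Hⁿ`. -/
def matPolyEval {H : Type*} [NormedAddCommGroup H] [InnerProductSpace ℂ H]
    {n : ℕ} (T : H →L[ℂ] H)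
    (F : Matrix (Fin n) (Fin n) (Polynomial ℂ)) :
    (PiLp 2 fun _ : Fin n => H) →L[ℂ] (PiLp 2 fun _ : Fin n => H) :=
  ((PiLp.continuousLinearEquiv 2 ℂ fun _ : Fin n => H).symm :
      (Fin n → H) →L[ℂ] PiLp 2 fun _ : Fin n => H) ∘L
    (pi fun i => ∑ j, (aeval T (F i j)) ∘L proj j) ∘L
    ((PiLp.continuousLinearEquiv 2 ℂ fun _ : Fin n => H) :
      (PiLp 2 fun _ : Fin n => H) →L[ℂ] (Fin n → H))

/-- The supremum norm `‖F‖_K = sup_{z ∈ K} ‖F(z)‖` of an `n × n` matrix polynomial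
over a set `K ⊆ ℂ`, where `‖F(z)‖` is the operator norm of the matrix `F(z)` on `ℂⁿ`. -/
def matPolyNorm {n : ℕ} (K : Set ℂ) (F : Matrix (Fin n) (Fin n) (Polynomial ℂ)) : ℝ :=
  sSup {r : ℝ | ∃ z ∈ K, r = ‖Matrix.toEuclideanCLM (𝕜 := ℂ) (F.map (Polynomial.eval z))‖}

/-- The `(n + n) × (n + n)` matrix polynomial `[[a, b F], [0, a]]`. -/
def upperBlock {n : ℕ} (a b : ℂ) (F : Matrix (Fin n) (Fin n) ℂ[X]) :
    Matrix (Fin (n + n)) (Fin (n + n)) ℂ[X] :=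
  Matrix.reindex finSumFinEquiv finSumFinEquiv
    (Matrix.fromBlocks (Matrix.diagonal fun _ => Polynomial.C a) (Polynomial.C b • F) 0
      (Matrix.diagonal fun _ => Polynomial.C a))

section upperBlock

variable {n : ℕ} (a b : ℂ) (F : Matrix (Fin n) (Fin n) ℂ[X]) (i j : Fin n)

@[simp] lemma upperBlock_castAdd_castAdd :
    upperBlock a b F (Fin.castAdd n i) (Fin.castAdd n j) =
      if i = j then Polynomial.C a else 0 := by
  simp [upperBlock, Matrix.diagonal_apply]

@[simp] lemma upperBlock_castAdd_natAdd :
    upperBlock a b F (Fin.castAdd n i) (Fin.natAdd n j) = Polynomial.C b * F i j := by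
  simp [upperBlock, -Fin.natAdd_eq_addNat]

@[simp] lemma upperBlock_natAdd_castAdd :
    upperBlock a b F (Fin.natAdd n i) (Fin.castAdd n j) = 0 := by
  simp [upperBlock, -Fin.natAdd_eq_addNat]

@[simp] lemma upperBlock_natAdd_natAdd :
    upperBlock a b F (Fin.natAdd n i) (Fin.natAdd n j) =
      if i = j then Polynomial.C a else 0 := by
  simp [upperBlock, Matrix.diagonal_apply, -Fin.natAdd_eq_addNat]

end upperBlock

lemma matPolyEval_apply {H : Type*} [NormedAddCommGroup H] [InnerProductSpace ℂ H] {n : ℕ}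
    (T : H →L[ℂ] H) (F : Matrix (Fin n) (Fin n) ℂ[X]) (x : PiLp 2 fun _ : Fin n => H)
    (i : Fin n) : matPolyEval T F x i = ∑ j, aeval T (F i j) (x j) := by
  simp [matPolyEval]

lemma toEuclideanCLM_map_eval_apply {n : ℕ} (F : Matrix (Fin n) (Fin n) ℂ[X]) (z : ℂ)
    (x : EuclideanSpace ℂ (Fin n)) (i : Fin n) :
    Matrix.toEuclideanCLM (𝕜 := ℂ) (F.map (Polynomial.eval z)) x i =
      ∑ j, (F i j).eval z * x j := by
  simp [Matrix.ofLp_toEuclideanCLM, Matrix.mulVec, dotProduct]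

lemma norm_inner_le_numRadius {E : Type*} [NormedAddCommGroup E] [InnerProductSpace ℂ E]
    (X : E →L[ℂ] E) (x : E) : ‖(⟪x, X x⟫_ℂ : ℂ)‖ ≤ numRadius X * ‖x‖ ^ 2 := by
  rcases eq_or_ne x 0 with rfl | hx
  · simp
  have hx' : 0 < ‖x‖ := norm_pos_iff.2 hx
  have hbdd : BddAbove {r : ℝ | ∃ x : E, ‖x‖ = 1 ∧ r = ‖(⟪x, X x⟫_ℂ : ℂ)‖} := by
    refine ⟨‖X‖, ?_⟩
    rintro r ⟨y, hy, rfl⟩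
    calc ‖(⟪y, X y⟫_ℂ : ℂ)‖ ≤ ‖y‖ * ‖X y‖ := norm_inner_le_norm _ _
      _ ≤ ‖y‖ * (‖X‖ * ‖y‖) := by gcongr; exact X.le_opNorm y
      _ = ‖X‖ := by simp [hy]
  have key := le_csSup hbdd ⟨((‖x‖⁻¹ : ℝ) : ℂ) • x, by
    rw [norm_smul]; simp [hx'.ne'], rfl⟩
  rw [map_smul, inner_smul_left, inner_smul_right, norm_mul, norm_mul] at key
  simp only [Complex.conj_ofReal, Complex.norm_real, norm_inv, norm_norm] at key
  rw [← mul_assoc, ← mul_inv, inv_mul_le_iff₀ (by positivity)] at key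
  rw [numRadius]
  linarith

/-- The numerical radius of `[[a, b F(T)], [0, a]]` is at least `a + b ‖F(T) v‖ / 2` for every
unit vector `v`. -/
lemma le_numRadius_upperBlock {H : Type*} [NormedAddCommGroup H] [InnerProductSpace ℂ H] {n : ℕ}
    (T : H →L[ℂ] H) (F : Matrix (Fin n) (Fin n) ℂ[X]) (a b : ℝ)
    (v : PiLp 2 fun _ : Fin n => H) (hv : ‖v‖ = 1) (hFv : matPolyEval T F v ≠ 0) :
    a + b * ‖matPolyEval T F v‖ / 2 ≤ numRadius (matPolyEval T (upperBlock a b F)) := by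
  set y := matPolyEval T F v with hy
  have hy0 : 0 < ‖y‖ := norm_pos_iff.2 hFv
  set u : PiLp 2 fun _ : Fin n => H := ((‖y‖⁻¹ : ℝ) : ℂ) • y with hu
  have hu1 : ‖u‖ = 1 := by rw [hu, norm_smul]; simp [hy0.ne']
  set w : PiLp 2 fun _ : Fin (n + n) => H :=
    WithLp.toLp 2 (Fin.addCases (fun i => u i) (fun i => v i)) with hw
  have hwl (i : Fin n) : w (Fin.castAdd n i) = u i := by simp [hw]
  have hwr (i : Fin n) : w (Fin.natAdd n i) = v i := by simp [hw, -Fin.natAdd_eq_addNat]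
  have hwn : ‖w‖ ^ 2 = 2 := by
    rw [PiLp.norm_sq_eq_of_L2, Fin.sum_univ_add]
    simp only [hwl, hwr]
    rw [← PiLp.norm_sq_eq_of_L2, ← PiLp.norm_sq_eq_of_L2, hu1, hv]
    norm_num
  have hGl (i : Fin n) : matPolyEval T (upperBlock a b F) w (Fin.castAdd n i) =
      ((a : ℂ) • u + (b : ℂ) • y) i := by
    rw [matPolyEval_apply, Fin.sum_univ_add]
    simp [hwl, hwr, hy, matPolyEval_apply, apply_ite (aeval T), Finset.smul_sum,
      DFunLike.ite_apply, Algebra.algebraMap_eq_smul_one, -Fin.natAdd_eq_addNat]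
  have hGr (i : Fin n) : matPolyEval T (upperBlock a b F) w (Fin.natAdd n i) =
      ((a : ℂ) • v) i := by
    rw [matPolyEval_apply, Fin.sum_univ_add]
    simp [hwl, hwr, apply_ite (aeval T), DFunLike.ite_apply,
      Algebra.algebraMap_eq_smul_one, -Fin.natAdd_eq_addNat]
  have huu : ⟪u, u⟫_ℂ = 1 := by rw [inner_self_eq_norm_sq_to_K, hu1]; simp
  have hvv : ⟪v, v⟫_ℂ = 1 := by rw [inner_self_eq_norm_sq_to_K, hv]; simp
  have huy : ⟪u, y⟫_ℂ = ‖y‖ := by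
    have : (‖y‖ : ℂ) ≠ 0 := by exact_mod_cast hy0.ne'
    rw [hu, inner_smul_left, inner_self_eq_norm_sq_to_K, Complex.conj_ofReal, Complex.ofReal_inv]
    change (‖y‖ : ℂ)⁻¹ * (‖y‖ : ℂ) ^ 2 = ‖y‖
    field_simp
  clear_value u
  have hin : ⟪w, matPolyEval T (upperBlock a b F) w⟫_ℂ = ((2 * a + b * ‖y‖ : ℝ) : ℂ) := by
    rw [PiLp.inner_apply, Fin.sum_univ_add]
    simp only [hwl, hwr, hGl, hGr]
    rw [← PiLp.inner_apply, ← PiLp.inner_apply, inner_add_right, inner_smul_right,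
      inner_smul_right, inner_smul_right, huu, hvv, huy]
    push_cast
    ring
  have h := norm_inner_le_numRadius (matPolyEval T (upperBlock a b F)) w
  rw [hin, hwn, Complex.norm_real] at h
  linarith [le_abs_self (2 * a + b * ‖y‖), Real.norm_eq_abs (2 * a + b * ‖y‖)]

/-- If `‖F(z)‖ ≤ r`, then `[[a, (1 - a²) r⁻¹ F(z)], [0, a]]` is a contraction. -/
lemma norm_upperBlock_le_one {n : ℕ} (F : Matrix (Fin n) (Fin n) ℂ[X]) (z : ℂ) {a r : ℝ}
    (ha0 : 0 ≤ a) (ha1 : a ≤ 1) (hr : 0 < r)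
    (hF : ‖Matrix.toEuclideanCLM (𝕜 := ℂ) (F.map (Polynomial.eval z))‖ ≤ r) :
    ‖Matrix.toEuclideanCLM (𝕜 := ℂ)
      ((upperBlock a ((1 - a ^ 2) / r : ℝ) F).map (Polynomial.eval z))‖ ≤ 1 := by
  refine ContinuousLinearMap.opNorm_le_bound _ zero_le_one fun w => ?_
  set b : ℝ := (1 - a ^ 2) / r with hb
  have hb0 : 0 ≤ b := div_nonneg (by nlinarith) hr.le
  have hbr : b * r = 1 - a ^ 2 := div_mul_cancel₀ _ hr.ne'
  set u : EuclideanSpace ℂ (Fin n) := WithLp.toLp 2 fun i => w (Fin.castAdd n i) with hu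
  set v : EuclideanSpace ℂ (Fin n) := WithLp.toLp 2 fun i => w (Fin.natAdd n i) with hv
  set A := Matrix.toEuclideanCLM (𝕜 := ℂ) (F.map (Polynomial.eval z)) with hA
  set G := Matrix.toEuclideanCLM (𝕜 := ℂ) ((upperBlock a b F).map (Polynomial.eval z)) with hG
  have hwn : ‖w‖ ^ 2 = ‖u‖ ^ 2 + ‖v‖ ^ 2 := by
    rw [EuclideanSpace.norm_sq_eq, EuclideanSpace.norm_sq_eq, EuclideanSpace.norm_sq_eq,
      Fin.sum_univ_add]
  have hGl (i : Fin n) : G w (Fin.castAdd n i) = ((a : ℂ) • u + (b : ℂ) • A v) i := by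
    rw [hG, toEuclideanCLM_map_eval_apply, Fin.sum_univ_add, PiLp.add_apply, PiLp.smul_apply,
      PiLp.smul_apply, hA, toEuclideanCLM_map_eval_apply]
    simp [hu, hv, apply_ite (Polynomial.eval z), Finset.mul_sum, mul_assoc,
      -Fin.natAdd_eq_addNat]
  have hGr (i : Fin n) : G w (Fin.natAdd n i) = ((a : ℂ) • v) i := by
    rw [hG, toEuclideanCLM_map_eval_apply, Fin.sum_univ_add]
    simp [hv, apply_ite (Polynomial.eval z), -Fin.natAdd_eq_addNat]
  have hGn : ‖G w‖ ^ 2 = ‖(a : ℂ) • u + (b : ℂ) • A v‖ ^ 2 + ‖(a : ℂ) • v‖ ^ 2 := by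
    rw [EuclideanSpace.norm_sq_eq, EuclideanSpace.norm_sq_eq, EuclideanSpace.norm_sq_eq,
      Fin.sum_univ_add]
    simp only [hGl, hGr]
  have h1 : ‖(a : ℂ) • u + (b : ℂ) • A v‖ ≤ a * ‖u‖ + (1 - a ^ 2) * ‖v‖ := by
    refine (norm_add_le _ _).trans ?_
    rw [norm_smul, norm_smul, Complex.norm_real, Complex.norm_real, Real.norm_of_nonneg ha0,
      Real.norm_of_nonneg hb0, ← hbr, mul_assoc b]
    gcongr
    exact A.le_of_opNorm_le hF v
  have h2 : ‖(a : ℂ) • v‖ = a * ‖v‖ := by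
    rw [norm_smul, Complex.norm_real, Real.norm_of_nonneg ha0]
  rw [one_mul]
  refine (sq_le_sq₀ (norm_nonneg _) (norm_nonneg _)).1 ?_
  have h3 : ‖(a : ℂ) • u + (b : ℂ) • A v‖ ^ 2 ≤ (a * ‖u‖ + (1 - a ^ 2) * ‖v‖) ^ 2 := by gcongr
  rw [hGn, hwn, h2]
  have h4 : 0 ≤ (1 - a ^ 2) * (‖u‖ - a * ‖v‖) ^ 2 := mul_nonneg (by nlinarith) (sq_nonneg _)
  linarith

lemma norm_le_matPolyNorm {n : ℕ} {K : Set ℂ} (hK : IsCompact K)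
    (F : Matrix (Fin n) (Fin n) ℂ[X]) {z : ℂ} (hz : z ∈ K) :
    ‖Matrix.toEuclideanCLM (𝕜 := ℂ) (F.map (Polynomial.eval z))‖ ≤ matPolyNorm K F := by
  have hM : Continuous fun z : ℂ => F.map (Polynomial.eval z) :=
    continuous_matrix fun i j => (F i j).continuous
  have hlin : Continuous (Matrix.toEuclideanCLM (n := Fin n) (𝕜 := ℂ)) :=
    LinearMap.continuous_of_finiteDimensional
      (Matrix.toEuclideanCLM (n := Fin n) (𝕜 := ℂ)).toAlgEquiv.toLinearMap
  obtain ⟨B, hB⟩ := hK.exists_bound_of_continuousOn (hlin.comp hM).continuousOn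
  refine le_csSup ⟨B, ?_⟩ ⟨z, hz, rfl⟩
  rintro r ⟨z, hz, rfl⟩
  exact hB z hz

/-- If `K` is a complete `(1/2)(C + C⁻¹)`-numerical radius set for `T`, then `K`
is a complete `C`-spectral set for `T`. -/
theorem complete_spectral_set_of_numRadius_le {H : Type*} [NormedAddCommGroup H]
    [InnerProductSpace ℂ H] [CompleteSpace H] (T : H →L[ℂ] H) (K : Set ℂ)
    (hK : IsCompact K) (C : ℝ) (hC : 1 ≤ C)
    (h : ∀ n : ℕ, 1 ≤ n → ∀ F : Matrix (Fin n) (Fin n) (Polynomial ℂ),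
      numRadius (matPolyEval T F) ≤ (1 / 2) * (C + C⁻¹) * matPolyNorm K F) :
    ∀ n : ℕ, 1 ≤ n → ∀ F : Matrix (Fin n) (Fin n) (Polynomial ℂ),
      ‖matPolyEval T F‖ ≤ C * matPolyNorm K F := by
  intro n hn F
  have hC0 : 0 < C := by linarith
  have hm0 : 0 ≤ matPolyNorm K F := by
    refine Real.sSup_nonneg ?_
    rintro r ⟨z, -, rfl⟩
    exact norm_nonneg _
  suffices H : ∀ r, matPolyNorm K F < r → ‖matPolyEval T F‖ ≤ C * r by
    rw [mul_comm, ← div_le_iff₀ hC0]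
    refine le_of_forall_gt_imp_ge_of_dense fun r hr => ?_
    rw [div_le_iff₀ hC0, mul_comm]
    exact H r hr
  intro r hmr
  have hr : 0 < r := hm0.trans_lt hmr
  refine ContinuousLinearMap.opNorm_le_of_unit_norm (𝕜 := ℂ) (by positivity) fun v hv => ?_
  by_contra! hlt
  set c := ‖matPolyEval T F v‖ / r with hc
  have hcr : ‖matPolyEval T F v‖ = c * r := (div_mul_cancel₀ _ hr.ne').symm
  have hCc : C < c := by rwa [hc, lt_div_iff₀ hr]
  have hc0 : 0 < c := hC0.trans hCc
  have hc1 : c⁻¹ ≤ 1 := inv_le_one_of_one_le₀ (by linarith)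
  have hne : matPolyEval T F v ≠ 0 := by
    rw [← norm_pos_iff, hcr]
    positivity
  have hG : matPolyNorm K (upperBlock (c⁻¹ : ℝ) ((1 - c⁻¹ ^ 2) / r : ℝ) F) ≤ 1 := by
    refine Real.sSup_le ?_ zero_le_one
    rintro s ⟨z, hz, rfl⟩
    exact norm_upperBlock_le_one F z (by positivity) hc1 hr
      ((norm_le_matPolyNorm hK F hz).trans hmr.le)
  have h1 := le_numRadius_upperBlock T F c⁻¹ ((1 - c⁻¹ ^ 2) / r) v hv hne
  have h2 := h (n + n) (by omega) (upperBlock (c⁻¹ : ℝ) ((1 - c⁻¹ ^ 2) / r : ℝ) F)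
  have h3 : (1 / 2) * (C + C⁻¹) *
      matPolyNorm K (upperBlock (c⁻¹ : ℝ) ((1 - c⁻¹ ^ 2) / r : ℝ) F) ≤ (1 / 2) * (C + C⁻¹) :=
    mul_le_of_le_one_right (by positivity) hG
  have h4 : c⁻¹ + (1 - c⁻¹ ^ 2) / r * ‖matPolyEval T F v‖ / 2 = (1 / 2) * (c + c⁻¹) := by
    rw [hcr]
    field_simp
    ring
  have h5 : c + c⁻¹ ≤ C + C⁻¹ := by linarith
  have h6 : c + c⁻¹ - (C + C⁻¹) = (c - C) * (c * C - 1) / (c * C) := by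
    field_simp
    ring
  have h7 : 0 < (c - C) * (c * C - 1) / (c * C) :=
    div_pos (mul_pos (by linarith) (by nlinarith)) (by positivity)
  linarith

end
end

section
/- Let H be a complex Hilbert space, T a bounded linear operator on H, and C ≥ 1. Suppose the numerical range W(T) is a complete C-spectral set for T in the sense that ‖F(T)‖ ≤ C · ‖F‖_{W(T)} for every n ≥ 1 and every n×n matrix polynomial F. Then w(F(T)) ≤ (1/2)(C + C⁻¹) · ‖F‖_{W(T)} for every n ≥ 1 and every n×n matrix polynomial F. -/
open scoped InnerProductSpace
open ContinuousLinearMap Polynomial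

noncomputable section

/-- The pseudo-hyperbolic inequality `‖w - a v‖ ≤ ‖v - a w‖` for `‖w‖ ≤ ‖v‖` and `0 ≤ a ≤ 1`. -/
theorem norm_sub_smul_le_of_norm_le {E : Type*} [NormedAddCommGroup E] [InnerProductSpace ℂ E]
    {v w : E} (hwv : ‖w‖ ≤ ‖v‖) {a : ℝ} (ha0 : 0 ≤ a) (ha1 : a ≤ 1) :
    ‖w - (a : ℂ) • v‖ ≤ ‖v - (a : ℂ) • w‖ := by
  refine le_of_sq_le_sq ?_ (norm_nonneg _)
  rw [@norm_sub_sq ℂ, @norm_sub_sq ℂ, inner_smul_right, inner_smul_right, norm_smul, norm_smul,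
    ← inner_conj_symm w v]
  simp only [RCLike.re_to_complex, Complex.re_ofReal_mul, Complex.conj_re, Complex.norm_real,
    Real.norm_eq_abs, abs_of_nonneg ha0]
  have h1 : ‖w‖ ^ 2 ≤ ‖v‖ ^ 2 := by gcongr
  have h2 : a ^ 2 ≤ 1 := by nlinarith
  nlinarith

section AbstractSpectral

variable {ι B E V : Type*} [Ring B] [Algebra ℂ B]
  [NormedAddCommGroup E] [InnerProductSpace ℂ E] [NormedAddCommGroup V] [InnerProductSpace ℂ V]

/-- The von Neumann inequality with constant `C` for the disc automorphism
`z ↦ (z - a) / (1 - a z)`, in division-free form. -/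
theorem norm_sub_smul_le_mul_of_spectral (θ : B →ₐ[ℂ] (E →L[ℂ] E)) (φ : ι → B →ₐ[ℂ] (V →L[ℂ] V))
    {C : ℝ} (hθ : ∀ G : B, ∀ M : ℝ, 0 ≤ M → (∀ i, ‖φ i G‖ ≤ M) → ‖θ G‖ ≤ C * M)
    {F : B} (hF : ∀ i, ‖φ i F‖ ≤ 1) {a : ℝ} (ha0 : 0 ≤ a) (ha1 : a < 1) (y : E) :
    ‖θ F y - (a : ℂ) • y‖ ≤ C * ‖y - (a : ℂ) • θ F y‖ := by
  have hpow (N : ℕ) (i : ι) : ‖φ i (F ^ N)‖ ≤ 1 := by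
    rw [map_pow]
    induction N with
    | zero => simpa [one_def] using norm_id_le (𝕜 := ℂ) (E := V)
    | succ k ih =>
      rw [pow_succ]
      exact (norm_mul_le _ _).trans (mul_le_one₀ ih (norm_nonneg _) (hF i))
  set b : B := (a : ℂ) • F with hb
  have hbN (N : ℕ) : b ^ N = ((a ^ N : ℝ) : ℂ) • F ^ N := by
    rw [hb, _root_.smul_pow, Complex.ofReal_pow]
  have key (N : ℕ) :
      ‖(θ F - (a : ℂ) • 1) (y - θ (b ^ N) y)‖ ≤ C * (1 + a ^ N) * ‖y - (a : ℂ) • θ F y‖ := by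
    set S : B := ∑ k ∈ Finset.range N, b ^ k with hS
    have hG : ‖θ ((F - (a : ℂ) • 1) * S)‖ ≤ C * (1 + a ^ N) := by
      refine hθ _ _ (by positivity) fun i => ?_
      refine ContinuousLinearMap.opNorm_le_bound _ (by positivity) fun v => ?_
      have h1 : ‖φ i F (φ i S v)‖ ≤ ‖φ i S v‖ := by
        simpa using (φ i F).le_of_opNorm_le (hF i) (φ i S v)
      have h2 : φ i S v - (a : ℂ) • φ i F (φ i S v) = v - φ i (b ^ N) v := by
        have hφb : φ i b = (a : ℂ) • φ i F := map_smul _ _ _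
        have := congrArg (fun G => φ i G v) (mul_neg_geom_sum b N)
        simpa [-map_sum, -map_pow, -Complex.coe_smul, ← hS, sub_mul, hφb] using this
      have h3 : ‖φ i (b ^ N) v‖ ≤ a ^ N * ‖v‖ := by
        rw [hbN, map_smul, _root_.smul_apply, norm_smul, Complex.norm_real,
          Real.norm_of_nonneg (by positivity)]
        gcongr
        simpa using (φ i (F ^ N)).le_of_opNorm_le (hpow N i) v
      calc ‖φ i ((F - (a : ℂ) • 1) * S) v‖
          = ‖φ i F (φ i S v) - (a : ℂ) • φ i S v‖ := by simp [-map_sum, -Complex.coe_smul, sub_mul]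
        _ ≤ ‖φ i S v - (a : ℂ) • φ i F (φ i S v)‖ := norm_sub_smul_le_of_norm_le h1 ha0 ha1.le
        _ = ‖v - φ i (b ^ N) v‖ := by rw [h2]
        _ ≤ ‖v‖ + ‖φ i (b ^ N) v‖ := norm_sub_le _ _
        _ ≤ (1 + a ^ N) * ‖v‖ := by linarith
    have hmul : (F - (a : ℂ) • 1) * S * (1 - b) = (F - (a : ℂ) • 1) * (1 - b ^ N) := by
      rw [mul_assoc, geom_sum_mul_neg]
    have h4 := congrArg (fun G => θ G y) hmul
    have h5 : (θ F - (a : ℂ) • 1) (y - θ (b ^ N) y)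
        = θ ((F - (a : ℂ) • 1) * S) (y - (a : ℂ) • θ F y) := by
      have hθb : θ b = (a : ℂ) • θ F := map_smul _ _ _
      rw [map_mul, map_mul θ _ (1 - b ^ N)] at h4
      generalize (F - (a : ℂ) • 1) * S = G at h4 ⊢
      simpa [-map_pow, -Complex.coe_smul, hθb] using h4.symm
    rw [h5]
    exact ContinuousLinearMap.le_of_opNorm_le _ hG _
  have hapow : Filter.Tendsto (fun N : ℕ => a ^ N) Filter.atTop (nhds 0) :=
    tendsto_pow_atTop_nhds_zero_of_lt_one ha0 ha1
  have hb0 : Filter.Tendsto (fun N : ℕ => θ (b ^ N) y) Filter.atTop (nhds 0) := by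
    refine squeeze_zero_norm (a := fun N => a ^ N * (C * 1 * ‖y‖)) (fun N => ?_)
      (by simpa using hapow.mul_const (C * 1 * ‖y‖))
    rw [hbN, map_smul, _root_.smul_apply, norm_smul, Complex.norm_real,
      Real.norm_of_nonneg (by positivity)]
    gcongr
    exact ContinuousLinearMap.le_of_opNorm_le _ (hθ _ 1 zero_le_one (hpow N)) y
  have hlim := le_of_tendsto_of_tendsto'
    (((θ F - (a : ℂ) • 1).continuous.tendsto _).comp (tendsto_const_nhds.sub hb0)).norm
    (((hapow.const_add 1).const_mul C).mul_const ‖y - (a : ℂ) • θ F y‖) key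
  simpa using hlim

/-- A unital homomorphism with spectral constant `C` sends contractions to operators whose
numerical range lies in the half-plane `re ≤ (C + C⁻¹) / 2`. -/
theorem re_inner_le_of_spectral (θ : B →ₐ[ℂ] (E →L[ℂ] E)) (φ : ι → B →ₐ[ℂ] (V →L[ℂ] V))
    {C : ℝ} (hC : 1 ≤ C) (hθ : ∀ G : B, ∀ M : ℝ, 0 ≤ M → (∀ i, ‖φ i G‖ ≤ M) → ‖θ G‖ ≤ C * M)
    {F : B} (hF : ∀ i, ‖φ i F‖ ≤ 1) {x : E} (hx : ‖x‖ = 1) :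
    (⟪x, θ F x⟫_ℂ).re ≤ (1 / 2) * (C + C⁻¹) := by
  rcases hC.eq_or_lt with rfl | hC1
  · calc (⟪x, θ F x⟫_ℂ).re ≤ ‖x‖ * ‖θ F x‖ := (Complex.re_le_norm _).trans (norm_inner_le_norm _ _)
      _ ≤ 1 * (1 * 1 * ‖x‖) := by
        rw [hx]
        gcongr
        simpa [hx] using (θ F).le_of_opNorm_le (hθ F 1 zero_le_one hF) x
      _ = _ := by rw [hx]; norm_num
  · have hC0 : 0 < C := by linarith
    have hD0 : 0 < C⁻¹ := by positivity
    have hCD : C * C⁻¹ = 1 := mul_inv_cancel₀ hC0.ne'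
    have hD1 : C⁻¹ < 1 := inv_lt_one_of_one_lt₀ hC1
    have h := norm_sub_smul_le_mul_of_spectral θ φ hθ hF hD0.le hD1 x
    have hsq := pow_le_pow_left₀ (norm_nonneg _) h 2
    rw [mul_pow, @norm_sub_sq ℂ, @norm_sub_sq ℂ, inner_smul_right, inner_smul_right, norm_smul,
      norm_smul, ← inner_conj_symm (θ F x) x] at hsq
    simp only [RCLike.re_to_complex, Complex.re_ofReal_mul, Complex.conj_re, Complex.norm_real,
      Real.norm_eq_abs, abs_of_pos hD0, hx] at hsq
    set D := C⁻¹
    set m := (⟪x, θ F x⟫_ℂ).re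
    have h1 : C ^ 2 * (1 ^ 2 - 2 * (D * m) + (D * ‖θ F x‖) ^ 2)
        = C ^ 2 - 2 * (C * D) * C * m + (C * D) ^ 2 * ‖θ F x‖ ^ 2 := by ring
    rw [h1, hCD] at hsq
    have h2 : 0 < C - D := by linarith
    nlinarith

end AbstractSpectral

/-- Evaluation of matrix polynomials at an operator, as an algebra homomorphism. -/
def matPolyEvalAlgHom {H : Type*} [NormedAddCommGroup H] [InnerProductSpace ℂ H] {n : ℕ}
    (T : H →L[ℂ] H) : Matrix (Fin n) (Fin n) (Polynomial ℂ) →ₐ[ℂ]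
      ((PiLp 2 fun _ : Fin n => H) →L[ℂ] (PiLp 2 fun _ : Fin n => H)) :=
  AlgHom.ofLinearMap
    { toFun := matPolyEval T
      map_add' := fun F G => by
        ext x i
        simp [matPolyEval, Finset.sum_add_distrib]
      map_smul' := fun c F => by
        ext x i
        simp [matPolyEval, Finset.smul_sum] }
    (by
      ext x i
      have hite (j : Fin n) : (if i = j then (1 : H →L[ℂ] H) else 0) (x j)
          = if i = j then x j else 0 := by split_ifs <;> rfl
      simp [matPolyEval, Matrix.one_apply, apply_ite (aeval T), hite])
    (fun F G => by
      ext x i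
      simp only [matPolyEval, Matrix.mul_apply, map_sum, map_mul, LinearMap.coe_mk, AddHom.coe_mk]
      simp
      exact Finset.sum_comm)

/-- Pointwise evaluation of matrix polynomials, as an algebra homomorphism. -/
def matPolyPointEval {n : ℕ} (z : ℂ) : Matrix (Fin n) (Fin n) (Polynomial ℂ) →ₐ[ℂ]
    (EuclideanSpace ℂ (Fin n) →L[ℂ] EuclideanSpace ℂ (Fin n)) :=
  (Matrix.toEuclideanCLM (n := Fin n) (𝕜 := ℂ)).toAlgEquiv.toAlgHom.comp (aeval z).mapMatrix

theorem norm_matPolyPointEval_le_matPolyNorm {n : ℕ} {K : Set ℂ} (hK : Bornology.IsBounded K)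
    (F : Matrix (Fin n) (Fin n) (Polynomial ℂ)) {z : ℂ} (hz : z ∈ K) :
    ‖matPolyPointEval z F‖ ≤ matPolyNorm K F := by
  have hcont : Continuous fun z => ‖matPolyPointEval z F‖ := by
    have h1 : Continuous fun z : ℂ => F.map (Polynomial.eval z) :=
      continuous_matrix fun i j => (F i j).continuous
    have h2 : Continuous (Matrix.toEuclideanCLM (n := Fin n) (𝕜 := ℂ)) :=
      LinearMap.continuous_of_finiteDimensional
        (Matrix.toEuclideanCLM (n := Fin n) (𝕜 := ℂ)).toAlgEquiv.toLinearMap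
    exact (h2.comp h1).norm
  have hbdd : BddAbove ((fun z => ‖matPolyPointEval z F‖) '' closure K) :=
    (hK.isCompact_closure.image hcont).bddAbove
  refine le_csSup (hbdd.mono ?_) ⟨z, hz, rfl⟩
  rintro r ⟨w, hw, rfl⟩
  exact ⟨w, subset_closure hw, rfl⟩

theorem isBounded_numRange {E : Type*} [NormedAddCommGroup E] [InnerProductSpace ℂ E]
    (X : E →L[ℂ] E) : Bornology.IsBounded (numRange X) := by
  refine isBounded_iff_forall_norm_le.2 ⟨‖X‖, ?_⟩
  rintro z ⟨x, hx, rfl⟩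
  simpa [hx] using (norm_inner_le_norm x (X x)).trans
    (mul_le_mul_of_nonneg_left (X.le_opNorm x) (norm_nonneg x))

theorem matPolyNorm_nonneg {n : ℕ} (K : Set ℂ) (F : Matrix (Fin n) (Fin n) (Polynomial ℂ)) :
    0 ≤ matPolyNorm K F := by
  refine Real.sSup_nonneg ?_
  rintro r ⟨z, -, rfl⟩
  exact norm_nonneg _

/-- If the numerical range `W(T)` is a complete `C`-spectral set for `T`, then
`w(F(T)) ≤ (1/2)(C + C⁻¹)·‖F‖_{W(T)}` for every matrix polynomial `F`. -/
theorem numRadius_le_of_numRange_complete_spectral {H : Type*} [NormedAddCommGroup H]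
    [InnerProductSpace ℂ H] [CompleteSpace H] (T : H →L[ℂ] H) (C : ℝ) (hC : 1 ≤ C)
    (h : ∀ n : ℕ, 1 ≤ n → ∀ F : Matrix (Fin n) (Fin n) (Polynomial ℂ),
      ‖matPolyEval T F‖ ≤ C * matPolyNorm (numRange T) F) :
    ∀ n : ℕ, 1 ≤ n → ∀ F : Matrix (Fin n) (Fin n) (Polynomial ℂ),
      numRadius (matPolyEval T F) ≤ (1 / 2) * (C + C⁻¹) * matPolyNorm (numRange T) F := by
  intro n hn F
  have hN0 := matPolyNorm_nonneg (numRange T) F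
  set N := matPolyNorm (numRange T) F with hN
  have hC0 : 0 < C := by linarith
  refine Real.sSup_le ?_ (by positivity)
  rintro r ⟨x, hx, rfl⟩
  set c : ℂ := ⟪x, matPolyEval T F x⟫_ℂ with hc
  rcases hN0.eq_or_lt with h0 | hpos
  · have hA : matPolyEval T F = 0 := by
      rw [← norm_le_zero_iff]
      simpa [← hN, ← h0] using h n hn F
    simp [hc, hA, ← h0]
  rcases eq_or_ne c 0 with hc0 | hc0
  · rw [hc0, norm_zero]; positivity
  have hcn : (‖c‖ : ℂ) ≠ 0 := by simpa using hc0
  set u : ℂ := (‖c‖ : ℂ) / c with hu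
  have hu1 : ‖u‖ = 1 := by simp [hu, hc0]
  have hF : ∀ z : numRange T, ‖matPolyPointEval (z : ℂ) ((u / N) • F)‖ ≤ 1 := fun z => by
    rw [map_smul, norm_smul, norm_div, hu1, Complex.norm_real, Real.norm_of_nonneg hN0,
      one_div, inv_mul_le_iff₀ hpos, mul_one]
    exact norm_matPolyPointEval_le_matPolyNorm (isBounded_numRange T) F z.2
  have hmain := re_inner_le_of_spectral (matPolyEvalAlgHom T)
    (fun z : numRange T => matPolyPointEval (z : ℂ)) hC
    (fun G M hM hG => (h n hn G).trans (by
      gcongr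
      refine Real.sSup_le ?_ hM
      rintro r ⟨z, hz, rfl⟩
      exact hG ⟨z, hz⟩)) hF hx
  have hval : ⟪x, matPolyEvalAlgHom T ((u / N) • F) x⟫_ℂ = ((‖c‖ / N : ℝ) : ℂ) := by
    have : ⟪x, matPolyEvalAlgHom T ((u / N) • F) x⟫_ℂ = u / N * c := by
      rw [map_smul, _root_.smul_apply, inner_smul_right]
      rfl
    rw [this, hu]
    push_cast
    field_simp
  rw [hval, Complex.ofReal_re, div_le_iff₀ hpos] at hmain
  exact hmain

end
end
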